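/- Let n ≥ 1636 be an integer. Then the real functions f(p) = sqrt(p(3n+2p−7)/12) − p + 1 and g(p) = sqrt((p(3n+2p−7)+3)/12) − p + 3/2 are increasing in p on the interval 2 ≤ p ≤ 4·sqrt((n−1)/2) − 3. -/

import Mathlib

theorem aux_step (A c x y : ℝ) (hc0 : 0 ≤ c) (hc : c ≤ 3) (hx : 2 ≤ x) (hxy : x < y)
    (hA : 43 * y ≤ A) :
    Real.sqrt ((x * (A + 2 * x) + c) / 12) + (y - x) < Real.sqrt ((y * (A + 2 * y) + c) / 12) := by
  obtain ⟨t, ht⟩ : ∃ t, t = A - 43 * y := ⟨_, rfl⟩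
  obtain ⟨d, hd⟩ : ∃ d, d = y - x := ⟨_, rfl⟩
  have ht0 : 0 ≤ t := by linarith
  have hd0 : 0 < d := by linarith
  obtain rfl : A = 43 * y + t := by linarith
  obtain rfl : y = x + d := by linarith
  have hs : Real.sqrt ((x * (43 * (x + d) + t + 2 * x) + c) / 12)
      < (43 * (x + d) + t + 14 * x - 10 * (x + d)) / 24 := by
    rw [Real.sqrt_lt' (by linarith)]
    have h1 : 0 ≤ t * d := by positivity
    have h2 : 0 ≤ t * x := by positivity
    have h3 : 0 ≤ x * d := by positivity
    have h4 : 0 < x * d := by positivity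
    nlinarith [sq_nonneg t, sq_nonneg d]
  have h0 : 0 ≤ (x * (43 * (x + d) + t + 2 * x) + c) / 12 := by positivity
  have hq := Real.sq_sqrt h0
  apply Real.lt_sqrt_of_sq_lt
  nlinarith [mul_lt_mul_of_pos_left hs hd0]

theorem aux_bound (n : ℕ) (hn : 1636 ≤ n) (y : ℝ)
    (hy : y ≤ 4 * Real.sqrt (((n : ℝ) - 1) / 2) - 3) : 43 * y ≤ 3 * (n : ℝ) - 7 := by
  have hn' : (1636 : ℝ) ≤ n := by exact_mod_cast hn
  have hq := Real.sq_sqrt (show 0 ≤ ((n : ℝ) - 1) / 2 by linarith)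
  have h28 : 28 ≤ Real.sqrt (((n : ℝ) - 1) / 2) := by
    apply Real.le_sqrt_of_sq_le
    linarith
  nlinarith

/-- **Lemma 7.** For an integer `n ≥ 1636`, the functions
`f(p) = sqrt(p(3n+2p-7)/12) - p + 1` and `g(p) = sqrt((p(3n+2p-7)+3)/12) - p + 3/2`
are (strictly) increasing on the interval `2 ≤ p ≤ 4·sqrt((n-1)/2) - 3`. -/
theorem f_g_strictMonoOn (n : ℕ) (hn : 1636 ≤ n) :
    StrictMonoOn (fun p : ℝ => Real.sqrt (p * (3 * (n : ℝ) + 2 * p - 7) / 12) - p + 1)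
      (Set.Icc 2 (4 * Real.sqrt (((n : ℝ) - 1) / 2) - 3)) ∧
    StrictMonoOn
      (fun p : ℝ => Real.sqrt ((p * (3 * (n : ℝ) + 2 * p - 7) + 3) / 12) - p + 3 / 2)
      (Set.Icc 2 (4 * Real.sqrt (((n : ℝ) - 1) / 2) - 3)) := by
  constructor
  · intro x hx y hy hxy
    have h := aux_step (3 * (n : ℝ) - 7) 0 x y le_rfl (by norm_num) hx.1 hxy
      (aux_bound n hn y hy.2)
    have e : ∀ z : ℝ, z * (3 * (n : ℝ) + 2 * z - 7) / 12
        = (z * (3 * (n : ℝ) - 7 + 2 * z) + 0) / 12 := fun z => by ring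
    simp only [e]
    linarith
  · intro x hx y hy hxy
    have h := aux_step (3 * (n : ℝ) - 7) 3 x y (by norm_num) le_rfl hx.1 hxy
      (aux_bound n hn y hy.2)
    have e : ∀ z : ℝ, (z * (3 * (n : ℝ) + 2 * z - 7) + 3) / 12
        = (z * (3 * (n : ℝ) - 7 + 2 * z) + 3) / 12 := fun z => by ring
    simp only [e]
    linarith
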